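/- Let v be a complete Llull matrix on a finite set A, with rank-like rates R, indirect comparison relation ν = {(x,y) : v*_{xy} > v*_{yx}} and codual ν̂ = {(x,y) : x ≠ y, v*_{xy} ≥ v*_{yx}}. Then for all distinct x, y: R_x < R_y if and only if (y,x) does not belong to the transitive closure of ν̂; and R_x ≤ R_y if and only if (x,y) belongs to the transitive closure of ν̂. -/

import Mathlib

/-! Common definitions: valued relations, indirect scores, admissible orders,
projected margins/scores, rank-like rates (Camps–Mora–Saumell CLC method). -/

variable {A : Type*} [Fintype A] [DecidableEq A]

/-- The score of a chain `x₀ :: x₁ :: ... :: xₙ`: the minimum of `v xᵢ xᵢ₊₁`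
over its links (value `1` for chains with no link, which we never use). -/
noncomputable def linkScore (v : A → A → ℝ) : List A → ℝ
  | [] => 1
  | [_] => 1
  | [a, b] => v a b
  | a :: b :: c :: l => min (v a b) (linkScore v (b :: c :: l))

/-- The indirect score `v*_{xy}`: the supremum (= maximum) of the scores of all
paths from `x` to `y` (with at least one link, consecutive elements distinct). -/
noncomputable def istar (v : A → A → ℝ) (x y : A) : ℝ :=
  sSup { s : ℝ | ∃ l : List A, List.Chain' (· ≠ ·) (x :: (l ++ [y])) ∧
      s = linkScore v (x :: (l ++ [y])) }

/-- `ξ` is a strict total order: irreflexive, transitive, total. -/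
def StrictTotal (ξ : A → A → Prop) : Prop :=
  (∀ x, ¬ ξ x x) ∧ (∀ x y z, ξ x y → ξ y z → ξ x z) ∧ (∀ x y, x ≠ y → ξ x y ∨ ξ y x)

/-- `ξ` is admissible for `v`: `v*_{xy} > v*_{yx}` implies `x` precedes `y`. -/
def Adm (v : A → A → ℝ) (ξ : A → A → Prop) : Prop :=
  ∀ x y, istar v x y > istar v y x → ξ x y

/-- Intermediate projected margin `m^σ_{xy}` (for `x` preceding `y` in `ξ`):
the infimum (= minimum) of the indirect margins `m*_{pq}` over `p ⪯ x`, `y ⪯ q`. -/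
noncomputable def msigma (v : A → A → ℝ) (ξ : A → A → Prop) (x y : A) : ℝ :=
  sInf { s : ℝ | ∃ p q, (ξ p x ∨ p = x) ∧ (ξ y q ∨ q = y) ∧
      s = istar v p q - istar v q p }

/-- `q` is the immediate successor of `p` in `ξ`. -/
def ImmSucc (ξ : A → A → Prop) (p q : A) : Prop :=
  ξ p q ∧ ∀ z, ¬ (ξ p z ∧ ξ z q)

/-- Projected margin (for `x` preceding `y` in `ξ`): the supremum (= maximum) of
`m^σ_{p p'}` over `x ⪯ p ≺ y`, `p'` the immediate successor of `p`. -/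
noncomputable def mpiAux (v : A → A → ℝ) (ξ : A → A → Prop) (x y : A) : ℝ :=
  sSup { s : ℝ | ∃ p q, (ξ x p ∨ p = x) ∧ ξ p y ∧ ImmSucc ξ p q ∧
      s = msigma v ξ p q }

open Classical in
/-- Projected margins `m^π`, extended antisymmetrically. -/
noncomputable def mpi (v : A → A → ℝ) (ξ : A → A → Prop) (x y : A) : ℝ :=
  if ξ x y then mpiAux v ξ x y else - mpiAux v ξ y x

/-- Projected scores `v^π_{xy} = (1 + m^π_{xy})/2`. -/
noncomputable def vpi (v : A → A → ℝ) (ξ : A → A → Prop) (x y : A) : ℝ :=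
  (1 + mpi v ξ x y) / 2

/-- Rank-like rate `R_x = N - ∑_{y ≠ x} v^π_{xy}`. -/
noncomputable def rlr (v : A → A → ℝ) (ξ : A → A → Prop) (x : A) : ℝ :=
  (Fintype.card A : ℝ) - ∑ y ∈ Finset.univ.erase x, vpi v ξ x y

/-- `v` is a complete Llull matrix: scores of distinct pairs lie in `[0,1]`
and satisfy `v_{xy} + v_{yx} = 1`. -/
def Llull (v : A → A → ℝ) : Prop :=
  ∀ x y : A, x ≠ y → 0 ≤ v x y ∧ v x y ≤ 1 ∧ v x y + v y x = 1

/-- The codual of the indirect comparison relation: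
`ν̂ = {(x,y) : x ≠ y, v*_{xy} ≥ v*_{yx}}`. -/
def nuhat {A : Type*} [Fintype A] [DecidableEq A] (v : A → A → ℝ) (x y : A) :
    Prop :=
  x ≠ y ∧ istar v x y ≥ istar v y x

omit [DecidableEq A] in
theorem msigma_set_finite (v : A → A → ℝ) (ξ : A → A → Prop) (x y : A) :
    { s : ℝ | ∃ p q, (ξ p x ∨ p = x) ∧ (ξ y q ∨ q = y) ∧
      s = istar v p q - istar v q p }.Finite := by
  refine (Set.finite_range fun r : A × A => istar v r.1 r.2 - istar v r.2 r.1).subset ?_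
  rintro s ⟨p, q, -, -, rfl⟩
  exact ⟨(p, q), rfl⟩

omit [DecidableEq A] in
theorem msigma_le (v : A → A → ℝ) {ξ : A → A → Prop} {x y p q : A}
    (hp : ξ p x ∨ p = x) (hq : ξ y q ∨ q = y) :
    msigma v ξ x y ≤ istar v p q - istar v q p :=
  csInf_le (msigma_set_finite v ξ x y).bddBelow ⟨p, q, hp, hq, rfl⟩

omit [DecidableEq A] in
theorem exists_msigma_eq (v : A → A → ℝ) (ξ : A → A → Prop) (x y : A) :
    ∃ p q, (ξ p x ∨ p = x) ∧ (ξ y q ∨ q = y) ∧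
      msigma v ξ x y = istar v p q - istar v q p :=
  Set.Nonempty.csInf_mem (s := { s : ℝ | ∃ p q, (ξ p x ∨ p = x) ∧ (ξ y q ∨ q = y) ∧
    s = istar v p q - istar v q p }) ⟨_, x, y, Or.inr rfl, Or.inr rfl, rfl⟩
    (msigma_set_finite v ξ x y)

omit [Fintype A] [DecidableEq A] in
theorem istar_le_of_adm {v : A → A → ℝ} {ξ : A → A → Prop} (hξ : StrictTotal ξ)
    (hadm : Adm v ξ) {x y : A} (h : ξ x y) : istar v y x ≤ istar v x y := by
  by_contra! hlt
  exact hξ.1 x (hξ.2.1 x y x h (hadm y x hlt))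

omit [DecidableEq A] in
theorem msigma_nonneg {v : A → A → ℝ} {ξ : A → A → Prop} (hξ : StrictTotal ξ)
    (hadm : Adm v ξ) {x y : A} (h : ξ x y) : 0 ≤ msigma v ξ x y := by
  obtain ⟨p, q, hp, hq, e⟩ := exists_msigma_eq v ξ x y
  have hpy : ξ p y := by
    rcases hp with hp | rfl
    · exact hξ.2.1 _ _ _ hp h
    · exact h
  have hpq : ξ p q := by
    rcases hq with hq | rfl
    · exact hξ.2.1 _ _ _ hpy hq
    · exact hpy
  rw [e, sub_nonneg]
  exact istar_le_of_adm hξ hadm hpq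

omit [DecidableEq A] in
theorem msigma_le_mpiAux (v : A → A → ℝ) {ξ : A → A → Prop} {x y p q : A}
    (hp : ξ x p ∨ p = x) (hy : ξ p y) (hq : ImmSucc ξ p q) :
    msigma v ξ p q ≤ mpiAux v ξ x y := by
  refine le_csSup (Set.Finite.bddAbove ?_) ⟨p, q, hp, hy, hq, rfl⟩
  refine (Set.finite_range fun r : A × A => msigma v ξ r.1 r.2).subset ?_
  rintro s ⟨p, q, -, -, -, rfl⟩
  exact ⟨(p, q), rfl⟩

omit [Fintype A] [DecidableEq A] in
theorem mpiAux_le {v : A → A → ℝ} {ξ : A → A → Prop} {x y : A} {c : ℝ} (hc : 0 ≤ c)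
    (h : ∀ p q, (ξ x p ∨ p = x) → ξ p y → ImmSucc ξ p q → msigma v ξ p q ≤ c) :
    mpiAux v ξ x y ≤ c := by
  refine Real.sSup_le ?_ hc
  rintro s ⟨p, q, h1, h2, h3, rfl⟩
  exact h p q h1 h2 h3

omit [DecidableEq A] in
theorem mpiAux_nonneg {v : A → A → ℝ} {ξ : A → A → Prop} (hξ : StrictTotal ξ)
    (hadm : Adm v ξ) (x y : A) : 0 ≤ mpiAux v ξ x y := by
  refine Real.sSup_nonneg ?_
  rintro s ⟨p, q, -, -, h3, rfl⟩
  exact msigma_nonneg hξ hadm h3.1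

omit [DecidableEq A] in
theorem mpiAux_mono {v : A → A → ℝ} {ξ : A → A → Prop} (hξ : StrictTotal ξ)
    (hadm : Adm v ξ) {x y x' y' : A} (hx : ξ x' x ∨ x = x') (hy : ξ y y' ∨ y = y') :
    mpiAux v ξ x y ≤ mpiAux v ξ x' y' := by
  refine mpiAux_le (mpiAux_nonneg hξ hadm _ _) fun p q h1 h2 h3 => msigma_le_mpiAux v ?_ ?_ h3
  · rcases hx with hx | rfl
    · rcases h1 with h1 | rfl
      · exact Or.inl (hξ.2.1 _ _ _ hx h1)
      · exact Or.inl hx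
    · exact h1
  · rcases hy with hy | rfl
    · exact hξ.2.1 _ _ _ h2 hy
    · exact h2

omit [DecidableEq A] in
theorem mpiAux_le_max {v : A → A → ℝ} {ξ : A → A → Prop} (hξ : StrictTotal ξ)
    (hadm : Adm v ξ) (x y z : A) :
    mpiAux v ξ x z ≤ max (mpiAux v ξ x y) (mpiAux v ξ y z) := by
  refine mpiAux_le (le_max_of_le_left (mpiAux_nonneg hξ hadm _ _)) fun p q h1 h2 h3 => ?_
  by_cases hpy : p = y
  · exact le_max_of_le_right (msigma_le_mpiAux v (Or.inr hpy) h2 h3)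
  rcases hξ.2.2 p y hpy with h | h
  · exact le_max_of_le_left (msigma_le_mpiAux v h1 h h3)
  · exact le_max_of_le_right (msigma_le_mpiAux v (Or.inl h) h2 h3)

omit [Fintype A] [DecidableEq A] in
theorem mpi_of_rel (v : A → A → ℝ) {ξ : A → A → Prop} {x y : A} (h : ξ x y) :
    mpi v ξ x y = mpiAux v ξ x y := if_pos h

omit [Fintype A] [DecidableEq A] in
theorem mpi_of_rel_swap (v : A → A → ℝ) {ξ : A → A → Prop} (hξ : StrictTotal ξ) {x y : A}
    (h : ξ x y) : mpi v ξ y x = - mpiAux v ξ x y :=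
  if_neg fun h' => hξ.1 x (hξ.2.1 _ _ _ h h')

omit [DecidableEq A] in
theorem mpi_antitone {v : A → A → ℝ} {ξ : A → A → Prop} (hξ : StrictTotal ξ)
    (hadm : Adm v ξ) {x y z : A} (h : ξ x y) (hzx : z ≠ x) (hzy : z ≠ y) :
    mpi v ξ y z ≤ mpi v ξ x z := by
  rcases hξ.2.2 z x hzx with h1 | h1
  · rw [mpi_of_rel_swap v hξ h1, mpi_of_rel_swap v hξ (hξ.2.1 _ _ _ h1 h), neg_le_neg_iff]
    exact mpiAux_mono hξ hadm (Or.inr rfl) (Or.inl h)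
  rcases hξ.2.2 z y hzy with h2 | h2
  · rw [mpi_of_rel v h1, mpi_of_rel_swap v hξ h2]
    linarith [mpiAux_nonneg hξ hadm x z, mpiAux_nonneg hξ hadm z y]
  · rw [mpi_of_rel v h1, mpi_of_rel v h2]
    exact mpiAux_mono hξ hadm (Or.inl h) (Or.inr rfl)

omit [DecidableEq A] in
theorem mpi_eq_of_mpiAux_eq_zero {v : A → A → ℝ} {ξ : A → A → Prop} (hξ : StrictTotal ξ)
    (hadm : Adm v ξ) {x y z : A} (h : ξ x y) (hzx : z ≠ x) (hzy : z ≠ y)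
    (h0 : mpiAux v ξ x y = 0) : mpi v ξ x z = mpi v ξ y z := by
  refine le_antisymm ?_ (mpi_antitone hξ hadm h hzx hzy)
  rcases hξ.2.2 z x hzx with h1 | h1
  · rw [mpi_of_rel_swap v hξ h1, mpi_of_rel_swap v hξ (hξ.2.1 _ _ _ h1 h), neg_le_neg_iff]
    have := mpiAux_le_max hξ hadm z x y
    rwa [h0, max_eq_left (mpiAux_nonneg hξ hadm _ _)] at this
  rcases hξ.2.2 z y hzy with h2 | h2
  · rw [mpi_of_rel v h1, mpi_of_rel_swap v hξ h2]
    linarith [mpiAux_mono hξ hadm (v := v) (x := x) (x' := x) (Or.inr rfl) (Or.inl h2),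
      mpiAux_mono hξ hadm (v := v) (y := y) (y' := y) (Or.inl h1) (Or.inr rfl)]
  · rw [mpi_of_rel v h1, mpi_of_rel v h2]
    have := mpiAux_le_max hξ hadm x y z
    rwa [h0, max_eq_right (mpiAux_nonneg hξ hadm _ _)] at this

theorem rlr_sub_rlr (v : A → A → ℝ) {ξ : A → A → Prop} (hξ : StrictTotal ξ) {x y : A}
    (h : ξ x y) : rlr v ξ y - rlr v ξ x = mpiAux v ξ x y +
      ∑ z ∈ (Finset.univ.erase x).erase y, (mpi v ξ x z - mpi v ξ y z) / 2 := by
  have hxy : x ≠ y := by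
    rintro rfl
    exact hξ.1 x h
  have h1 := Finset.add_sum_erase (Finset.univ.erase x) (vpi v ξ x)
    (Finset.mem_erase.2 ⟨hxy.symm, Finset.mem_univ y⟩)
  have h2 := Finset.add_sum_erase (Finset.univ.erase y) (vpi v ξ y)
    (Finset.mem_erase.2 ⟨hxy, Finset.mem_univ x⟩)
  rw [Finset.erase_right_comm] at h2
  have h3 : ∑ z ∈ (Finset.univ.erase x).erase y, (mpi v ξ x z - mpi v ξ y z) / 2 =
      ∑ z ∈ (Finset.univ.erase x).erase y, vpi v ξ x z -
        ∑ z ∈ (Finset.univ.erase x).erase y, vpi v ξ y z := by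
    rw [← Finset.sum_sub_distrib]
    refine Finset.sum_congr rfl fun z _ => ?_
    simp only [vpi]
    ring
  have h4 : vpi v ξ x y = (1 + mpiAux v ξ x y) / 2 := by rw [vpi, mpi_of_rel v h]
  have h5 : vpi v ξ y x = (1 - mpiAux v ξ x y) / 2 := by
    rw [vpi, mpi_of_rel_swap v hξ h, sub_eq_add_neg]
  rw [h3]
  unfold rlr
  linarith

theorem mpiAux_le_rlr_sub_rlr {v : A → A → ℝ} {ξ : A → A → Prop} (hξ : StrictTotal ξ)
    (hadm : Adm v ξ) {x y : A} (h : ξ x y) :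
    mpiAux v ξ x y ≤ rlr v ξ y - rlr v ξ x := by
  rw [rlr_sub_rlr v hξ h, le_add_iff_nonneg_right]
  refine Finset.sum_nonneg fun z hz => ?_
  simp only [Finset.mem_erase, Finset.mem_univ, and_true] at hz
  linarith [mpi_antitone hξ hadm h hz.2 hz.1]

theorem rlr_eq_iff {v : A → A → ℝ} {ξ : A → A → Prop} (hξ : StrictTotal ξ)
    (hadm : Adm v ξ) {x y : A} (h : ξ x y) :
    rlr v ξ x = rlr v ξ y ↔ mpiAux v ξ x y = 0 := by
  constructor
  · intro e
    linarith [mpiAux_le_rlr_sub_rlr hξ hadm h, mpiAux_nonneg hξ hadm x y]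
  · intro h0
    have e := rlr_sub_rlr v hξ h
    rw [h0, Finset.sum_eq_zero] at e
    · linarith
    · intro z hz
      simp only [Finset.mem_erase, Finset.mem_univ, and_true] at hz
      rw [mpi_eq_of_mpiAux_eq_zero hξ hadm h hz.2 hz.1 h0]
      simp

omit [DecidableEq A] in
theorem exists_immSucc {ξ : A → A → Prop} (hξ : StrictTotal ξ) {x y : A} (h : ξ x y) :
    ∃ q, ImmSucc ξ x q ∧ (ξ q y ∨ q = y) := by
  have : IsTrans A ξ := ⟨hξ.2.1⟩
  have : Std.Irrefl ξ := ⟨hξ.1⟩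
  obtain ⟨q, hq, hmin⟩ :=
    (Finite.wellFounded_of_trans_of_irrefl ξ).has_min {q | ξ x q} ⟨y, h⟩
  refine ⟨q, ⟨hq, fun z hz => hmin z hz.1 hz.2⟩, ?_⟩
  by_contra! hc
  exact (hξ.2.2 q y hc.2).elim hc.1 (hmin y h)

theorem nuhat_of_rel {v : A → A → ℝ} {ξ : A → A → Prop} (hξ : StrictTotal ξ)
    (hadm : Adm v ξ) {x y : A} (h : ξ x y) : nuhat v x y :=
  ⟨fun e => hξ.1 y (e ▸ h), istar_le_of_adm hξ hadm h⟩

theorem reflTransGen_nuhat_of_msigma_eq_zero {v : A → A → ℝ} {ξ : A → A → Prop}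
    (hξ : StrictTotal ξ) (hadm : Adm v ξ) {x y : A} (h0 : msigma v ξ x y = 0) :
    Relation.ReflTransGen (nuhat v) y x := by
  have hle : ∀ {a b : A}, (ξ a b ∨ a = b) → Relation.ReflTransGen (nuhat v) a b := by
    rintro a b (hab | rfl)
    · exact .single (nuhat_of_rel hξ hadm hab)
    · exact .refl
  obtain ⟨p, q, hp, hq, e⟩ := exists_msigma_eq v ξ x y
  have hqp : Relation.ReflTransGen (nuhat v) q p := by
    by_cases hne : q = p
    · rw [hne]
    · exact .single ⟨hne, by linarith⟩
  exact ((hle (hq.imp_right Eq.symm)).trans hqp).trans (hle hp)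

theorem reflTransGen_nuhat_of_mpiAux_eq_zero {v : A → A → ℝ} {ξ : A → A → Prop}
    (hξ : StrictTotal ξ) (hadm : Adm v ξ) {x y : A} (h : ξ x y)
    (h0 : mpiAux v ξ x y = 0) : Relation.ReflTransGen (nuhat v) y x := by
  have : IsTrans A (Function.swap ξ) := ⟨fun a b c hab hbc => hξ.2.1 c b a hbc hab⟩
  have : Std.Irrefl (Function.swap ξ) := ⟨hξ.1⟩
  induction x using (Finite.wellFounded_of_trans_of_irrefl (Function.swap ξ)).induction with
  | _ x ih =>
    obtain ⟨q, hq, hqy⟩ := exists_immSucc hξ h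
    have hs : msigma v ξ x q = 0 :=
      le_antisymm (h0 ▸ msigma_le_mpiAux v (Or.inr rfl) h hq) (msigma_nonneg hξ hadm hq.1)
    have hqx := reflTransGen_nuhat_of_msigma_eq_zero hξ hadm hs
    rcases hqy with hqy | rfl
    · refine (ih q hq.1 hqy (le_antisymm ?_ (mpiAux_nonneg hξ hadm _ _))).trans hqx
      rw [← h0]
      exact mpiAux_mono hξ hadm (Or.inl hq.1) (Or.inr rfl)
    · exact hqx

theorem msigma_nonpos_of_transGen {v : A → A → ℝ} {ξ : A → A → Prop} (hξ : StrictTotal ξ)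
    {x y p q : A} (hpq : ImmSucc ξ p q) (hx : ξ x p ∨ x = p) (hy : ξ q y ∨ y = q)
    (h : Relation.TransGen (nuhat v) y x) : msigma v ξ p q ≤ 0 := by
  have hcut : ∀ z, (ξ z p ∨ z = p) ∨ (ξ q z ∨ z = q) := by
    intro z
    by_contra! hc
    exact hpq.2 z ⟨(hξ.2.2 z p hc.1.2).resolve_left hc.1.1,
      (hξ.2.2 z q hc.2.2).resolve_right hc.2.1⟩
  induction h with
  | single hb => linarith [msigma_le v hx hy, hb.2]
  | @tail b c _ hb ih =>
    rcases hcut b with hbp | hqb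
    · exact ih hbp
    · linarith [msigma_le v hx hqb, hb.2]

theorem transGen_nuhat_iff_mpiAux_eq_zero {v : A → A → ℝ} {ξ : A → A → Prop}
    (hξ : StrictTotal ξ) (hadm : Adm v ξ) {x y : A} (h : ξ x y) :
    Relation.TransGen (nuhat v) y x ↔ mpiAux v ξ x y = 0 := by
  constructor
  · intro ht
    refine le_antisymm (mpiAux_le le_rfl fun p q h1 h2 h3 => ?_) (mpiAux_nonneg hξ hadm _ _)
    refine msigma_nonpos_of_transGen hξ h3 (h1.imp_right Eq.symm) ?_ ht
    by_contra! hc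
    exact h3.2 y ⟨h2, (hξ.2.2 y q hc.2).resolve_right hc.1⟩
  · intro h0
    refine (Relation.reflTransGen_iff_eq_or_transGen.1
      (reflTransGen_nuhat_of_mpiAux_eq_zero hξ hadm h h0)).resolve_left ?_
    rintro rfl
    exact hξ.1 _ h

/-- For all distinct `x, y`: `R_x < R_y` iff `(y,x)` is not in
the transitive closure of `ν̂`, and `R_x ≤ R_y` iff `(x,y)` is in the
transitive closure of `ν̂`. -/
theorem stmt10 {A : Type*} [Fintype A] [DecidableEq A] (v : A → A → ℝ)
    (hv : Llull v) (ξ : A → A → Prop) (hξ : StrictTotal ξ) (hadm : Adm v ξ) :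
    ∀ x y : A, x ≠ y →
      (rlr v ξ x < rlr v ξ y ↔ ¬ Relation.TransGen (nuhat v) y x) ∧
      (rlr v ξ x ≤ rlr v ξ y ↔ Relation.TransGen (nuhat v) x y) := by
  intro x y hxy
  have hR : ∀ {a b : A}, ξ a b → rlr v ξ a ≤ rlr v ξ b := fun {a b} h => by
    linarith [mpiAux_le_rlr_sub_rlr hξ hadm h, mpiAux_nonneg hξ hadm a b]
  have hT : ∀ {a b : A}, ξ a b → Relation.TransGen (nuhat v) a b :=
    fun h => .single (nuhat_of_rel hξ hadm h)
  have hE : ∀ {a b : A}, ξ a b →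
      (rlr v ξ a = rlr v ξ b ↔ Relation.TransGen (nuhat v) b a) := fun h =>
    (rlr_eq_iff hξ hadm h).trans (transGen_nuhat_iff_mpiAux_eq_zero hξ hadm h).symm
  rcases hξ.2.2 x y hxy with h | h
  · rw [← hE h]
    exact ⟨(hR h).lt_iff_ne, iff_of_true (hR h) (hT h)⟩
  · rw [← hE h]
    exact ⟨iff_of_false (hR h).not_gt (not_not_intro (hT h)), (hR h).ge_iff_eq⟩
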